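/- In the monoid M = Mon⟨a,b : a b² a² b² = b⟩, the inequality a·(ab²)²·a²·(ab²)² ≠ ab² holds; consequently, the assignment a ↦ a, b ↦ ab² does not extend to a monoid endomorphism of M. -/

import Mathlib

open Relation FreeMonoid

/-- Words over the alphabet `A`: the free monoid on `A`. -/
abbrev Word (A : Type) : Type := FreeMonoid A

/-- One-step rewriting relation of the rewriting system `R`. -/
def OneStep {A : Type} (R : Set (Word A × Word A)) (x y : Word A) : Prop :=
  ∃ u v l r : Word A, (l, r) ∈ R ∧ x = u * l * v ∧ y = u * r * v

/-- Confluence of the rewriting system `R`. -/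
def IsConfluent {A : Type} (R : Set (Word A × Word A)) : Prop :=
  ∀ w x y : Word A, ReflTransGen (OneStep R) w x → ReflTransGen (OneStep R) w y →
    ∃ z : Word A, ReflTransGen (OneStep R) x z ∧ ReflTransGen (OneStep R) y z

/-- Termination of the rewriting system `R`: no infinite rewriting chain. -/
def IsTerminating {A : Type} (R : Set (Word A × Word A)) : Prop :=
  ¬ ∃ f : ℕ → Word A, ∀ n : ℕ, OneStep R (f n) (f (n + 1))

/-- The monoid presented by generators `A` and relations `R`: the quotient of the
free monoid on `A` by the congruence generated by `R`. -/
abbrev MonPres {A : Type} (R : Set (Word A × Word A)) : Type :=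
  (conGen fun x y : Word A => (x, y) ∈ R).Quotient

/-- The canonical projection from words to the presented monoid. -/
def presMk {A : Type} (R : Set (Word A × Word A)) : Word A →* MonPres R :=
  Con.mk' _

/-- A two-letter alphabet. -/
inductive AB : Type | a | b

/-- A three-letter alphabet. -/
inductive ABX : Type | a | b | x


/-- The defining relation of `M = Mon⟨a,b : a b² a² b² = b⟩`. -/
def rel0 : Set (Word AB × Word AB) :=
  {((of AB.a) * (of AB.b)^2 * (of AB.a)^2 * (of AB.b)^2, of AB.b)}

/-- The element of `M` represented by the generator `a`. -/
def A0 : MonPres rel0 := presMk _ (of AB.a)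

/-- The element of `M` represented by the generator `b`. -/
def B0 : MonPres rel0 := presMk _ (of AB.b)

/-- Left multiplication by `a` on normal forms of the rewriting system
`axaxxx → xaxxax`, `axaxxax → x`, where `x = ab²`. Words are lists with `true` for `a` and
`false` for `x`. -/
def consA : List Bool → List Bool
  | false :: true :: false :: false :: false :: w =>
      false :: true :: false :: false :: consA (false :: w)
  | false :: true :: false :: false :: true :: false :: w => false :: w
  | w => true :: w

/-- Normal forms: every suffix `aw` is its own normal form. -/
def IsNormalForm : List Bool → Prop
  | [] => True
  | false :: w => IsNormalForm w
  | true :: w => IsNormalForm w ∧ consA w = true :: w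

theorem IsNormalForm.consA (w : List Bool) (hw : IsNormalForm w) :
    IsNormalForm (consA w) := by
  induction w using consA.induct with
  | case1 w ih =>
    rw [_root_.consA]
    exact ⟨ih hw.1, by simp [_root_.consA]⟩
  | case2 w => exact hw.1.1
  | case3 w h₁ h₂ =>
    have h : _root_.consA w = true :: w := _root_.consA.eq_3 w h₁ h₂
    rw [h]
    exact ⟨hw, h⟩

theorem consA_xaxx_consA (w : List Bool) (hw : IsNormalForm (false :: w)) :
    consA (false :: true :: false :: false :: consA (false :: w)) = false :: w := by
  generalize hv : false :: w = v at hw ⊢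
  induction v using consA.induct generalizing w with
  | case1 u ih =>
    rw [consA, consA, ih u rfl hw.1]
  | case2 u =>
    have h : consA (false :: u) = true :: false :: u := hw.1.2
    rw [consA, consA, h]
  | case3 v h₁ h₂ =>
    rw [consA.eq_3 v h₁ h₂, ← hv, consA]

theorem consA_relation (w : List Bool) (hw : IsNormalForm w) :
    consA (false :: consA (false :: false :: consA (false :: w))) = false :: w := by
  rw [show consA (false :: false :: consA (false :: w)) =
    true :: false :: false :: consA (false :: w) by simp [consA]]
  exact consA_xaxx_consA w hw

/-- The action of `a` on normal forms. -/
def actA : Function.End {w : List Bool // IsNormalForm w} :=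
  fun w => ⟨consA w.1, w.2.consA⟩

/-- The action of `x = ab²` on normal forms. -/
def actX : Function.End {w : List Bool // IsNormalForm w} :=
  fun w => ⟨false :: w.1, w.2⟩

theorem actA_actX_relation :
    actA * actX * actA * actX * actX * actA * actX = actX :=
  funext fun w => Subtype.ext (consA_relation w.1 w.2)

theorem actA_actX_ne : actA * actX ^ 2 * actA ^ 2 * actX ^ 2 ≠ actX := by
  intro h
  have h' := congrArg Subtype.val (congrFun h ⟨[], trivial⟩)
  simp only [pow_two] at h'
  change consA (false :: false :: consA (consA [false, false])) = [false] at h'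
  simp [consA] at h'

theorem A0_B0_relation : A0 * B0 ^ 2 * A0 ^ 2 * B0 ^ 2 = B0 :=
  (Con.eq _).2 (ConGen.Rel.of _ _ rfl)

/-- Elements `p`, `q` with `pqpqqpq = q` determine a homomorphism with `a ↦ p`, `b ↦ qpq`. -/
theorem exists_hom_of_relation {N : Type*} [Monoid N] {p q : N}
    (h : p * q * p * q * q * p * q = q) :
    ∃ f : MonPres rel0 →* N, f A0 = p ∧ f B0 = q * p * q := by
  have hx : p * (q * p * q) ^ 2 = q := by simpa only [pow_two, mul_assoc] using h
  let g : Word AB →* N := FreeMonoid.lift (fun c => AB.casesOn c p (q * p * q))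
  have hg : conGen (fun x y : Word AB => (x, y) ∈ rel0) ≤ Con.ker g := by
    refine Con.conGen_le.2 fun x y hxy => ?_
    obtain ⟨rfl, rfl⟩ := Prod.ext_iff.1 (Set.mem_singleton_iff.1 hxy)
    simp only [Con.ker_rel, map_mul, map_pow, g, FreeMonoid.lift_eval_of]
    rw [hx, pow_two p, mul_assoc, mul_assoc p p, hx, mul_assoc]
  exact ⟨Con.lift _ g hg, by simp [A0, presMk, g], by simp [B0, presMk, g]⟩

theorem A0_xx_relation_ne :
    A0 * (A0 * B0 ^ 2) ^ 2 * A0 ^ 2 * (A0 * B0 ^ 2) ^ 2 ≠ A0 * B0 ^ 2 := by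
  intro h
  obtain ⟨f, ha, hb⟩ := exists_hom_of_relation actA_actX_relation
  have hx : f (A0 * B0 ^ 2) = actX := by
    rw [map_mul, map_pow, ha, hb]
    simpa only [pow_two, mul_assoc] using actA_actX_relation
  apply actA_actX_ne
  have h' := congrArg f h
  generalize A0 * B0 ^ 2 = x at h' hx
  simpa only [map_mul, map_pow, hx, ha] using h'

/-- In `M`, `a·(ab²)²·a²·(ab²)² ≠ ab²`, hence `a ↦ a`, `b ↦ ab²` does not extend to a
monoid endomorphism of `M`. -/
theorem stmt16 :
    A0 * (A0 * B0^2)^2 * A0^2 * (A0 * B0^2)^2 ≠ A0 * B0^2 ∧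
    ¬ ∃ φ : MonPres rel0 →* MonPres rel0, φ A0 = A0 ∧ φ B0 = A0 * B0^2 := by
  refine ⟨A0_xx_relation_ne, ?_⟩
  rintro ⟨φ, ha, hb⟩
  apply A0_xx_relation_ne
  have h := congrArg φ A0_B0_relation
  rwa [map_mul, map_mul, map_mul, map_pow, map_pow, ha, hb] at h
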